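/- arXiv:1705.10604 — 2 statements merged into one kernel-verified Lean document; each statement's English description precedes it below -/
import Mathlib

section
/- Let D be an essentially small triangulated category embedded in D(Λ) as D^b(Λ), and let (X, Y) be a t-structure on D^b(Λ). Then the pair (X̃, Ỹ) := (^⊥(X^⊥), X^⊥), with orthogonals computed in the unbounded derived category D(Λ), is a t-structure on D(Λ), and it restricts to (X, Y) on D^b(Λ): X̃ ∩ D^b(Λ) = X and Ỹ ∩ D^b(Λ) = Y. -/
open CategoryTheory Category Limits Pretriangulated


namespace Paper

section
universe w v u
open MorphismProperty ZeroObject in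
theorem hasSOA {A : Type u} [Category.{v} A] [Abelian A] [IsGrothendieckAbelian.{w} A]
    {ι : Type w} (P R : ι → A) (i : ∀ t, P t ⟶ R t) [∀ t, Mono (i t)] :
    HasSmallObjectArgument.{w} (MorphismProperty.ofHoms i) := by
  obtain ⟨κ, hκ', hκ⟩ := HasCardinalLT.exists_regular_cardinal.{w} (Σ t, Subobject (P t))
  have : Fact κ.IsRegular := ⟨hκ'⟩
  have : Nonempty κ.ord.ToType := by simpa using hκ'.ne_zero
  have := WellFoundedLT.toOrderBot κ.ord.ToType
  have hle : MorphismProperty.ofHoms i ≤ monomorphisms A := by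
    rintro _ _ _ ⟨t⟩
    exact inferInstanceAs (Mono (i t))
  exact ⟨κ, inferInstance, inferInstance,
    { preservesColimit {A' B X Y} j hj f hf := by
        let hf' : (monomorphisms A).TransfiniteCompositionOfShape κ.ord.ToType f :=
          { toTransfiniteCompositionOfShape := hf.toTransfiniteCompositionOfShape
            map_mem j hj := by
              have := (hf.attachCells j hj).pushouts_coproducts
              simp only [ofHoms_homFamily] at this
              refine (?_ : _ ≤ monomorphisms A) _ this
              simp only [pushouts_le_iff, coproducts_le_iff]
              exact hle }
        have (j j' : κ.ord.ToType) (φ : j ⟶ j') : Mono (hf'.F.map φ) := hf'.mem_map φ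
        apply IsGrothendieckAbelian.preservesColimit_coyoneda_obj_of_mono (Y := hf'.F) (κ := κ)
        obtain ⟨t⟩ := hj
        exact hκ.of_injective (fun s => (⟨t, s⟩ : Σ t, Subobject (P t)))
          (fun a b h => by simpa using h) }⟩

open CochainComplex HomComplex

section
variable {A : Type u} [Category.{v} A] [Abelian A]

/-- null-homotopic, expressed through the cone of the identity. -/
def Nul {P Z : CochainComplex A ℤ} (f : P ⟶ Z) : Prop :=
  ∃ g : mappingCone (𝟙 P) ⟶ Z, mappingCone.inr (𝟙 P) ≫ g = f

theorem nul_iff {P Z : CochainComplex A ℤ} (f : P ⟶ Z) : Nul f ↔ Nonempty (Homotopy f 0) := by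
  constructor
  · rintro ⟨g, rfl⟩
    refine ⟨(Cochain.equivHomotopy _ _).symm
      ⟨(mappingCone.inl (𝟙 P)).comp (Cochain.ofHom g) (add_zero _), ?_⟩⟩
    simp
  · rintro ⟨h⟩
    obtain ⟨z, hz⟩ := Cochain.equivHomotopy _ _ h
    exact ⟨mappingCone.desc _ z f (by simpa using hz.symm), by simp⟩

/-- The projection from the cone of the identity. -/
noncomputable def pr (Z : CochainComplex A ℤ) : mappingCone (𝟙 Z) ⟶ Z⟦(1 : ℤ)⟧ :=
  (mappingCone.triangle (𝟙 Z)).mor₃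

theorem inr_pr (Z : CochainComplex A ℤ) : mappingCone.inr (𝟙 Z) ≫ pr Z = 0 :=
  mappingCone.inr_triangleδ (𝟙 Z)

theorem pr_sec (Z : CochainComplex A ℤ) (n : ℤ) :
    ∃ s : (Z⟦(1 : ℤ)⟧).X n ⟶ (mappingCone (𝟙 Z)).X n, s ≫ (pr Z).f n = 𝟙 _ := by
  have := mappingCone.inl_v_triangle_mor₃_f (𝟙 Z) (n + 1) n (by lia)
  refine ⟨-((Z.shiftFunctorObjXIso 1 n (n + 1) rfl).hom ≫
    (mappingCone.inl (𝟙 Z)).v (n + 1) n (by lia)), ?_⟩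
  rw [Preadditive.neg_comp, assoc]
  erw [this]
  rw [Preadditive.comp_neg, neg_neg, Iso.hom_inv_id]

theorem pr_fst (Z : CochainComplex A ℤ) (n : ℤ) :
    (mappingCone.fst (𝟙 Z)).1.v n (n + 1) rfl =
      -((pr Z).f n ≫ (Z.shiftFunctorObjXIso 1 n (n + 1) rfl).hom) := by
  apply mappingCone.ext_from _ (n + 1) n rfl
  · have := mappingCone.inl_v_triangle_mor₃_f (𝟙 Z) (n + 1) n (by lia)
    rw [mappingCone.inl_v_fst_v, Preadditive.comp_neg, ← assoc]
    erw [this]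
    rw [Preadditive.neg_comp, neg_neg, Iso.inv_hom_id]
  · have : (mappingCone.inr (𝟙 Z)).f n ≫ (pr Z).f n = 0 := by
      rw [← HomologicalComplex.comp_f, inr_pr, HomologicalComplex.zero_f]
    rw [mappingCone.inr_f_fst_v, Preadditive.comp_neg, ← assoc, this, zero_comp, neg_zero]

theorem pr_ker (Z W : CochainComplex A ℤ) (f : W ⟶ mappingCone (𝟙 Z)) (hf : f ≫ pr Z = 0) :
    ∃ w : W ⟶ Z, w ≫ mappingCone.inr (𝟙 Z) = f := by
  have hf' (n : ℤ) : f.f n ≫ (mappingCone.fst (𝟙 Z)).1.v n (n + 1) rfl = 0 := by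
    have : f.f n ≫ (pr Z).f n = 0 := by
      rw [← HomologicalComplex.comp_f, hf, HomologicalComplex.zero_f]
    rw [pr_fst, Preadditive.comp_neg, ← assoc, this, zero_comp, neg_zero]
  have h2 (n : ℤ) : (f.f n ≫ (mappingCone.snd (𝟙 Z)).v n n (add_zero n)) ≫
      (mappingCone.inr (𝟙 Z)).f n = f.f n := by
    conv_rhs => rw [← comp_id (f.f n), ← mappingCone.id_X (𝟙 Z) n (n + 1) rfl]
    rw [Preadditive.comp_add, ← assoc, hf' n]; simp
  have hm (n : ℤ) : Mono ((mappingCone.inr (𝟙 Z)).f n) :=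
    ⟨fun a b hab => by
      have := congrArg (fun t => t ≫ (mappingCone.snd (𝟙 Z)).v n n (add_zero n)) hab
      simpa using this⟩
  refine ⟨{ f := fun n => f.f n ≫ (mappingCone.snd (𝟙 Z)).v n n (add_zero n), comm' := ?_ }, ?_⟩
  · rintro i j hij
    have := hm j
    have h3 := h2 i
    have h4 := h2 j
    rw [assoc] at h3 h4
    rw [← cancel_mono ((mappingCone.inr (𝟙 Z)).f j), assoc, assoc, assoc, assoc, h4,
      ← (mappingCone.inr (𝟙 Z)).comm, reassoc_of% h3, f.comm]
  · ext n; exact h2 n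

theorem gen_lift {P Z E B : CochainComplex A ℤ} (k : Z ⟶ E) (p : E ⟶ B) (hkp : k ≫ p = 0)
    (hsec : ∀ n, ∃ s : B.X n ⟶ E.X n, s ≫ p.f n = 𝟙 _)
    (hker : ∀ (f : P ⟶ E), f ≫ p = 0 → ∃ w : P ⟶ Z, w ≫ k = f)
    (hPZ : ∀ f : P ⟶ Z, Nul f) :
    HasLiftingProperty (mappingCone.inr (𝟙 P)) p := by
  refine ⟨fun {u v} sq => ?_⟩
  choose s hs using hsec
  let α : Cochain P B (-1) :=
    (mappingCone.inl (𝟙 P)).comp (Cochain.ofHom v) (add_zero _)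
  let γ : Cochain P E (-1) := α.comp (Cochain.ofHoms s) (add_zero _)
  have hγ : γ.comp (Cochain.ofHom p) (add_zero _) = α := by
    ext p q hpq
    simp [γ, hs]
  let β : P ⟶ E := Cocycle.homOf (Cocycle.mk (δ (-1) 0 γ) 1 (by lia) (δ_δ _ _ _ _))
  have hβ : Cochain.ofHom β = δ (-1) 0 γ := by simp [β]
  let l₀ : mappingCone (𝟙 P) ⟶ E := mappingCone.desc _ γ β (by simp [hβ])
  have hl₀ : l₀ ≫ p = v := by
    have h0 : β ≫ p = mappingCone.inr (𝟙 P) ≫ v := by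
      apply (Cochain.ofHom_injective)
      rw [Cochain.ofHom_comp, hβ]
      have := congrArg (δ (-1) 0) hγ
      simp at this
      rw [this]
      simp [α]
    ext n
    apply mappingCone.ext_from _ (n + 1) n rfl
    · have := Cochain.congr_v hγ (n + 1) n (by lia)
      simpa [l₀, α] using this
    · have := congrArg (fun φ => φ.f n) h0
      simpa [l₀] using this
  obtain ⟨w, hw⟩ := hker (u - mappingCone.inr _ ≫ l₀) (by
    rw [Preadditive.sub_comp, assoc, hl₀, sq.w, sub_self])
  obtain ⟨w', rfl⟩ := hPZ w
  refine ⟨⟨⟨l₀ + w' ≫ k, ?_, ?_⟩⟩⟩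
  · rw [Preadditive.comp_add, ← assoc, hw]; abel
  · rw [Preadditive.add_comp, assoc, hkp, hl₀]; simp

theorem pr_lift (P Z : CochainComplex A ℤ) (hPZ : ∀ f : P ⟶ Z, Nul f) :
    HasLiftingProperty (mappingCone.inr (𝟙 P)) (pr Z) :=
  gen_lift (mappingCone.inr (𝟙 Z)) (pr Z) (inr_pr Z) (pr_sec Z) (pr_ker Z P) hPZ

theorem inr_mono (P : CochainComplex A ℤ) : Mono (mappingCone.inr (𝟙 P)) := by
  refine ⟨fun a b hab => ?_⟩
  ext n
  have : a.f n ≫ (mappingCone.inr (𝟙 P)).f n = b.f n ≫ (mappingCone.inr (𝟙 P)).f n := by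
    rw [← HomologicalComplex.comp_f, hab, HomologicalComplex.comp_f]
  have := congrArg (fun t => t ≫ (mappingCone.snd (𝟙 P)).v n n (add_zero n)) this
  simpa using this

open MorphismProperty ZeroObject in
theorem thmA [IsGrothendieckAbelian.{w} A] {ι : Type w} (P : ι → CochainComplex A ℤ)
    (M : CochainComplex A ℤ) :
    ∃ S : ShortComplex (CochainComplex A ℤ), S.ShortExact ∧ S.X₁ = M ∧
      (∀ t (f : P t ⟶ S.X₂), Nul f) ∧
      ∀ Z : CochainComplex A ℤ, (∀ t (f : P t ⟶ Z), Nul f) →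
        ∀ f : S.X₃ ⟶ Z⟦(1 : ℤ)⟧, ∃ g, g ≫ pr Z = f := by
  have hm (t : ι) := inr_mono (P t)
  let I := MorphismProperty.ofHoms (fun t => mappingCone.inr (𝟙 (P t)))
  have : HasSmallObjectArgument.{w} I := hasSOA _ _ _
  let F := (functorialFactorizationData I.rlp.llp I.rlp).factorizationData (0 : M ⟶ 0)
  have hle : I ≤ monomorphisms _ := by
    rintro _ _ _ ⟨t⟩
    exact hm t
  have hi : Mono F.i := by
    have := (antitone_llp (antitone_rlp hle)) _ F.hi
    rwa [IsGrothendieckAbelian.llp_rlp_monomorphisms (isSeparator_separator _)] at this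
  refine ⟨ShortComplex.mk F.i (cokernel.π F.i) (by simp), ?_, rfl, ?_, ?_⟩
  · exact { exact := ShortComplex.exact_cokernel F.i, mono_f := hi, epi_g := inferInstance }
  · intro t f
    have := F.hp _ (MorphismProperty.ofHoms.mk (f := fun t => mappingCone.inr (𝟙 (P t))) t)
    have sq : CommSq f (mappingCone.inr (𝟙 (P t))) F.p 0 := ⟨(isZero_zero _).eq_of_tgt _ _⟩
    exact ⟨sq.lift, sq.fac_left⟩
  · intro Z hZ f
    dsimp at f ⊢
    have hp : I.rlp (pr Z) := by
      rintro _ _ _ ⟨t⟩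
      exact pr_lift _ _ (hZ t)
    have := F.hi _ hp
    have sq : CommSq 0 F.i (pr Z) (cokernel.π F.i ≫ f) := ⟨by simp⟩
    refine ⟨cokernel.desc F.i sq.lift sq.fac_left, ?_⟩
    rw [← cancel_epi (cokernel.π F.i), cokernel.π_desc_assoc, sq.fac_right]
end

end

section
universe w v u
open CochainComplex HomComplex

section
variable {A : Type u} [Category.{v} A] [Abelian A]

theorem homotopy_of_pr {C L : CochainComplex A ℤ}
    (h : ∀ f : C ⟶ (L⟦(-1 : ℤ)⟧)⟦(1 : ℤ)⟧, ∃ g, g ≫ pr (L⟦(-1 : ℤ)⟧) = f) (f : C ⟶ L) :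
    Nonempty (Homotopy f 0) := by
  let e : (L⟦(-1 : ℤ)⟧)⟦(1 : ℤ)⟧ ≅ L := (shiftFunctorCompIsoId (CochainComplex A ℤ) (-1 : ℤ) 1 (by simp)).app L
  obtain ⟨g, hg⟩ := h (f ≫ e.inv)
  have hf : f = (g ≫ 𝟙 _) ≫ pr (L⟦(-1 : ℤ)⟧) ≫ e.hom := by
    rw [comp_id, ← assoc, hg, assoc, e.inv_hom_id, comp_id]
  rw [hf]
  exact ⟨(((mappingCone.homotopyToZeroOfId _).compLeft g).compRight _).trans
    (Homotopy.ofEq (by simp))⟩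

variable [HasDerivedCategory.{w} A]
open DerivedCategory

theorem Q_nul {P Z : CochainComplex A ℤ} {f : P ⟶ Z} (h : Nul f) : Q.map f = 0 := by
  obtain ⟨h⟩ := (nul_iff f).1 h
  rw [Q_map_eq_of_homotopy _ h, Functor.map_zero]

theorem Q_kproj_surj {P Z : CochainComplex A ℤ} [P.IsKProjective] (g : Q.obj P ⟶ Q.obj Z) :
    ∃ f : P ⟶ Z, Q.map f = g := by
  obtain ⟨f, hf⟩ := (IsKProjective.Qh_map_bijective P
    ((HomotopyCategory.quotient _ _).obj Z)).surjective
    ((quotientCompQhIso A).hom.app P ≫ g ≫ (quotientCompQhIso A).inv.app Z)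
  obtain ⟨f, rfl⟩ := (HomotopyCategory.quotient _ _).map_surjective f
  refine ⟨f, ?_⟩
  have := quotientCompQhIso_hom_naturality f
  rw [hf] at this
  rw [← cancel_epi ((quotientCompQhIso A).hom.app P), ← this]
  simp

theorem Q_kproj_inj {P Z : CochainComplex A ℤ} [P.IsKProjective] (f : P ⟶ Z) (hf : Q.map f = 0) :
    Nul f := by
  rw [nul_iff]
  refine ⟨HomotopyCategory.homotopyOfEq _ _ ?_⟩
  apply (IsKProjective.Qh_map_bijective P _).injective
  have := quotientCompQhIso_hom_naturality f
  rw [← cancel_mono ((quotientCompQhIso A).hom.app Z), this, hf]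
  simp

end

section
variable {Λ : Type} [Ring Λ] 

theorem acyclic_of_nul (N : CochainComplex (ModuleCat.{0} Λ) ℤ)
    (h : ∀ (n : ℤ) (f : (HomologicalComplex.single (ModuleCat.{0} Λ) (.up ℤ) n).obj (ModuleCat.of Λ Λ) ⟶ N), Nul f) :
    N.Acyclic := by
  intro n
  rw [HomologicalComplex.exactAt_iff' N (n - 1) n (n + 1) (by simp) (by simp),
    ShortComplex.moduleCat_exact_iff]
  intro x0 hx0
  obtain ⟨x, hx, rfl⟩ : ∃ x : N.X n, (N.d n (n + 1)).hom x = 0 ∧ x = x0 := ⟨x0, hx0, rfl⟩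
  let φ : ModuleCat.of Λ Λ ⟶ N.X n := ModuleCat.ofHom (LinearMap.toSpanSingleton Λ _ x)
  have hφ1 : φ.hom (1 : Λ) = x := by
    change (1 : Λ) • x = x
    simp
  have hφ : ∀ i, (ComplexShape.up ℤ).Rel n i → φ ≫ N.d n i = 0 := by
    rintro i rfl
    refine ModuleCat.hom_ext (LinearMap.ext_ring ?_)
    change (N.d n (n + 1)).hom (φ.hom (1 : Λ)) = 0
    rw [hφ1, hx]
  obtain ⟨H⟩ := (nul_iff _).1 (h n (HomologicalComplex.mkHomFromSingle φ hφ))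
  have hc := H.comm n
  rw [dNext_eq H.hom (show (ComplexShape.up ℤ).Rel n (n + 1) by simp),
    prevD_eq H.hom (show (ComplexShape.up ℤ).Rel (n - 1) n by simp)] at hc
  have hc' : φ = ((HomologicalComplex.singleObjXSelf (.up ℤ) n (ModuleCat.of Λ Λ)).inv ≫
      H.hom n (n - 1)) ≫ N.d (n - 1) n := by
    rw [HomologicalComplex.mkHomFromSingle_f, ← Iso.eq_inv_comp] at hc
    refine hc.trans ?_
    simp
  refine ⟨((HomologicalComplex.singleObjXSelf (.up ℤ) n (ModuleCat.of Λ Λ)).inv ≫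
      H.hom n (n - 1)).hom (1 : Λ), ?_⟩
  have := congrArg (fun ψ => ψ.hom (1 : Λ)) hc'
  exact this.symm.trans hφ1

theorem single_kproj (n : ℤ) :
    IsKProjective ((HomologicalComplex.single (ModuleCat.{0} Λ) (.up ℤ) n).obj (ModuleCat.of Λ Λ)) := by
  have : Projective (ModuleCat.of Λ Λ) := ModuleCat.projective_of_free (Module.Free.chooseBasis Λ Λ)
  have : ∀ m, Projective (((HomologicalComplex.single (ModuleCat.{0} Λ) (.up ℤ) n).obj (ModuleCat.of Λ Λ)).X m) := by
    intro m
    by_cases h : m = n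
    · subst h
      exact Projective.of_iso (HomologicalComplex.singleObjXSelf (.up ℤ) m (ModuleCat.of Λ Λ)).symm this
    · exact (HomologicalComplex.isZero_single_obj_X (.up ℤ) n (ModuleCat.of Λ Λ) m h).projective
  exact isKProjective_of_projective _ n

variable [HasDerivedCategory.{w} (ModuleCat.{0} Λ)]
open DerivedCategory

theorem isZero_Q {L : CochainComplex (ModuleCat.{0} Λ) ℤ} (hL : L.Acyclic) :
    IsZero (Q.obj L) := by
  have : QuasiIso (0 : L ⟶ L) := by
    refine ⟨fun n => ?_⟩
    rw [quasiIsoAt_iff_isIso_homologyMap]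
    have hz : IsZero (L.homology n) := (hL n).isZero_homology
    exact ⟨0, hz.eq_of_src _ _, hz.eq_of_src _ _⟩
  have h2 : IsIso (Q.map (0 : L ⟶ L)) := (isIso_Q_map_iff_quasiIso _ _).2 this
  rw [IsZero.iff_id_eq_zero]
  rw [Functor.map_zero] at h2
  rw [← cancel_epi (0 : Q.obj L ⟶ Q.obj L)]
  simp

theorem kproj_res (M : CochainComplex (ModuleCat.{0} Λ) ℤ) :
    ∃ K : CochainComplex (ModuleCat.{0} Λ) ℤ, K.IsKProjective ∧ Nonempty (Q.obj K ≅ Q.obj M) := by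
  obtain ⟨S, hS, rfl, h1, h2⟩ := thmA.{0} (fun n : ℤ =>
    (HomologicalComplex.single (ModuleCat.{0} Λ) (.up ℤ) n).obj (ModuleCat.of Λ Λ)) M
  have hN := acyclic_of_nul _ h1
  have hK : S.X₃.IsKProjective := by
    refine ⟨fun {L} f hL => homotopy_of_pr (h2 _ ?_) f⟩
    intro n g
    have := single_kproj (Λ := Λ) n
    apply Q_kproj_inj
    have hz : IsZero (Q.obj (L⟦(-1 : ℤ)⟧)) :=
      ((CategoryTheory.shiftFunctor _ (-1 : ℤ)).map_isZero (isZero_Q hL)).of_iso ((Q.commShiftIso (-1 : ℤ)).app L)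
    exact hz.eq_of_tgt _ _
  refine ⟨S.X₃⟦(-1 : ℤ)⟧, inferInstance, ?_⟩
  have hT := triangleOfSES_distinguished hS
  have hz : IsZero (Q.obj S.X₂) := isZero_Q hN
  have : IsIso (triangleOfSESδ hS) := (Triangle.isZero₂_iff_isIso₃ _ hT).1 hz
  exact ⟨(Q.commShiftIso (-1 : ℤ)).app _ ≪≫ (CategoryTheory.shiftFunctor _ (-1 : ℤ)).mapIso
    (asIso (triangleOfSESδ hS)) ≪≫ (shiftFunctorCompIsoId _ (1 : ℤ) (-1) (by simp)).app _⟩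
end

end

section
universe w v u

section
variable {Λ : Type} [Ring Λ]

section
variable [HasDerivedCategory.{w} (ModuleCat.{0} Λ)]
open DerivedCategory

theorem isIso_Q_of {N M : CochainComplex (ModuleCat.{0} Λ) ℤ} (f : N ⟶ M)
    (hinj : ∀ i, Function.Injective (f.f i).hom)
    (h : ∀ (i : ℤ) (x : M.X i) (y : N.X (i + 1)), (M.d i (i + 1)).hom x = (f.f (i + 1)).hom y →
      ∃ (n : N.X i) (w : M.X (i - 1)), x = (f.f i).hom n + (M.d (i - 1) i).hom w) :
    IsIso (Q.map f) := by
  have : ∀ i, Mono (f.f i) := fun i => (ModuleCat.mono_iff_injective _).2 (hinj i)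
  have : Mono f := HomologicalComplex.mono_of_mono_f _ this
  have hS : (ShortComplex.mk f (cokernel.π f) (cokernel.condition f)).ShortExact :=
    { exact := ShortComplex.exact_cokernel f
      mono_f := inferInstance
      epi_g := inferInstance }
  have hT := triangleOfSES_distinguished hS
  refine (Triangle.isZero₃_iff_isIso₁ _ hT).1 (isZero_Q ?_)
  intro n
  dsimp only
  have hSi := fun i => hS.map_of_exact (HomologicalComplex.eval (ModuleCat.{0} Λ) (.up ℤ) i)
  have hex : ∀ i (x : M.X i), ((cokernel.π f).f i).hom x = 0 → ∃ y, (f.f i).hom y = x :=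
    fun i x hx => (ShortComplex.moduleCat_exact_iff _).1 (hSi i).exact x hx
  have hsu : ∀ i (x : (cokernel f).X i), ∃ y, ((cokernel.π f).f i).hom y = x := fun i x =>
    (ModuleCat.epi_iff_surjective _).1 (hSi i).epi_g x
  have hco : ∀ i j (x : M.X i), ((cokernel f).d i j).hom (((cokernel.π f).f i).hom x) =
      ((cokernel.π f).f j).hom ((M.d i j).hom x) := by
    intro i j x
    have := congrArg (fun ψ => ψ.hom x) ((cokernel.π f).comm i j)
    exact this
  have hz : ∀ i (x : N.X i), ((cokernel.π f).f i).hom ((f.f i).hom x) = 0 := by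
    intro i x
    have := congrArg (fun ψ : N ⟶ cokernel f => (HomologicalComplex.Hom.f ψ i).hom x) (cokernel.condition f)
    exact this
  rw [HomologicalComplex.exactAt_iff' _ (n - 1) n (n + 1) (by simp) (by simp),
    ShortComplex.moduleCat_exact_iff]
  intro x0 hx0
  obtain ⟨x, hx, rfl⟩ : ∃ x : (cokernel f).X n, ((cokernel f).d n (n + 1)).hom x = 0 ∧ x = x0 :=
    ⟨x0, hx0, rfl⟩
  obtain ⟨x, rfl⟩ := hsu _ x
  rw [hco] at hx
  obtain ⟨y, hy⟩ := hex _ _ hx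
  obtain ⟨m, w, rfl⟩ := h n x y hy.symm
  refine ⟨((cokernel.π f).f (n - 1)).hom w, ?_⟩
  refine (hco _ _ _).trans ?_
  rw [map_add, hz, zero_add]

end

/-- Formal terms. -/
inductive Term (Λ : Type) : ℤ → Type
  | gen (i : ℤ) (j : ℕ) : Term Λ i
  | zero (i : ℤ) : Term Λ i
  | add {i : ℤ} (a b : Term Λ i) : Term Λ i
  | smul {i : ℤ} (r : Λ) (a : Term Λ i) : Term Λ i
  | d (i j : ℤ) (a : Term Λ i) : Term Λ j
  | c (i j : ℤ) (a : Term Λ j) : Term Λ i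

/-- The formal differential. -/
noncomputable def DD (Λ : Type) [Ring Λ] (i j : ℤ) : (Term Λ i →₀ Λ) →ₗ[Λ] (Term Λ j →₀ Λ) :=
  Finsupp.lmapDomain Λ Λ (Term.d i j)

/-- Codes for complexes. -/
def Code (Λ : Type) [Ring Λ] : Type :=
  {K : ∀ i, Submodule Λ (Term Λ i →₀ Λ) // (∀ i j, K i ≤ (K j).comap (DD Λ i j)) ∧
    (∀ i j, ¬ (ComplexShape.up ℤ).Rel i j → ∀ x, DD Λ i j x ∈ K j) ∧
    ∀ i j l x, DD Λ j l (DD Λ i j x) ∈ K l}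

/-- The complex of a code. -/
noncomputable def Code.cx (K : Code Λ) : CochainComplex (ModuleCat.{0} Λ) ℤ where
  X i := ModuleCat.of Λ ((Term Λ i →₀ Λ) ⧸ K.1 i)
  d i j := ModuleCat.ofHom ((K.1 i).mapQ (K.1 j) (DD Λ i j) (K.2.1 i j))
  shape i j hij := by
    refine ModuleCat.hom_ext (Submodule.linearMap_qext _ (LinearMap.ext fun x => ?_))
    exact (Submodule.Quotient.mk_eq_zero _).2 (K.2.2.1 i j hij x)
  d_comp_d' i j l _ _ := by
    refine ModuleCat.hom_ext (Submodule.linearMap_qext _ (LinearMap.ext fun x => ?_))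
    exact (Submodule.Quotient.mk_eq_zero _).2 (K.2.2.2 i j l x)

section
variable (M : CochainComplex (ModuleCat.{0} Λ) ℤ) (z : ∀ i, ℕ → M.X i)

open Classical in
/-- Evaluation of terms. -/
noncomputable def ev : ∀ {i : ℤ}, Term Λ i → M.X i
  | _, .gen i j => z i j
  | _, .zero _ => 0
  | _, .add a b => ev a + ev b
  | _, .smul r a => r • ev a
  | _, .d i j a => (M.d i j).hom (ev a)
  | _, .c i j a => if h : ∃ y : M.X i, (M.d i j).hom y = ev a then h.choose else 0

/-- Linearised evaluation. -/
noncomputable def lev (i : ℤ) : (Term Λ i →₀ Λ) →ₗ[Λ] M.X i :=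
  Finsupp.linearCombination Λ (fun t => ev M z t)

theorem lev_single (i : ℤ) (t : Term Λ i) : lev M z i (Finsupp.single t 1) = ev M z t := by
  simp [lev]

theorem lev_DD (i j : ℤ) (x) : lev M z j (DD Λ i j x) = (M.d i j).hom (lev M z i x) := by
  induction x using Finsupp.induction_linear with
  | zero => simp
  | add a b ha hb => simp only [map_add, ha, hb]
  | single a b => simp [lev, DD, Finsupp.lmapDomain_apply, Finsupp.mapDomain_single, ev]

theorem lev_range (i : ℤ) (x) : ∃ t : Term Λ i, ev M z t = lev M z i x := by
  induction x using Finsupp.induction_linear with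
  | zero => exact ⟨.zero i, by simp [ev]⟩
  | add a b ha hb =>
    obtain ⟨s, hs⟩ := ha
    obtain ⟨t, ht⟩ := hb
    exact ⟨.add s t, by simp only [map_add, ev, hs, ht]⟩
  | single a b => exact ⟨.smul b a, by simp [lev, ev]⟩

/-- The code of a complex. -/
noncomputable def code : Code Λ := ⟨fun i => LinearMap.ker (lev M z i), by
  refine ⟨fun i j x hx => ?_, fun i j hij x => ?_, fun i j l x => ?_⟩
  · rw [LinearMap.mem_ker] at hx
    rw [Submodule.mem_comap, LinearMap.mem_ker, lev_DD, hx, map_zero]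
  · rw [LinearMap.mem_ker, lev_DD, M.shape i j hij]
    rfl
  · rw [LinearMap.mem_ker, lev_DD, lev_DD]
    exact congrArg (fun ψ => ψ.hom (lev M z i x)) (M.d_comp_d i j l)⟩

/-- The map from the code complex. -/
noncomputable def codeMap : (code M z).cx ⟶ M where
  f i := ModuleCat.ofHom ((LinearMap.ker (lev M z i)).liftQ (lev M z i) le_rfl)
  comm' i j _ := by
    refine ModuleCat.hom_ext (Submodule.linearMap_qext _ (LinearMap.ext fun x => ?_))
    exact (lev_DD M z i j x).symm

theorem codeMap_mk (i : ℤ) (x : Term Λ i →₀ Λ) :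
    ((codeMap M z).f i).hom (Submodule.Quotient.mk x : (Term Λ i →₀ Λ) ⧸ LinearMap.ker (lev M z i))
      = lev M z i x := rfl

theorem codeMap_iso [HasDerivedCategory.{w} (ModuleCat.{0} Λ)]
    (hz : ∀ (i : ℤ) (x : M.X i), (M.d i (i + 1)).hom x = 0 →
      ∃ n ∈ Submodule.span Λ (Set.range (z i)), ∃ w : M.X (i - 1), x = n + (M.d (i - 1) i).hom w) :
    IsIso (DerivedCategory.Q.map (codeMap M z)) := by
  have hspan : ∀ i, Submodule.span Λ (Set.range (z i)) ≤ LinearMap.range (lev M z i) := by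
    intro i
    rw [Submodule.span_le]
    rintro _ ⟨j, rfl⟩
    exact ⟨Finsupp.single (.gen i j) 1, by rw [lev_single, ev]⟩
  refine isIso_Q_of _ (fun i => ?_) ?_
  · exact LinearMap.ker_eq_bot.1 (Submodule.ker_liftQ_eq_bot _ _ _ le_rfl)
  · intro i x y hxy
    obtain ⟨y, rfl⟩ : ∃ y', y = (Submodule.Quotient.mk y' :
        (Term Λ (i + 1) →₀ Λ) ⧸ LinearMap.ker (lev M z (i + 1))) := by
      obtain ⟨y', h⟩ := Submodule.Quotient.mk_surjective (LinearMap.ker (lev M z (i + 1))) y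
      exact ⟨y', h.symm⟩
    rw [codeMap_mk] at hxy
    obtain ⟨t, ht⟩ := lev_range M z (i + 1) y
    have hc : (M.d i (i + 1)).hom (ev M z (.c i (i + 1) t)) = ev M z t := by
      have hex : ∃ y : M.X i, (M.d i (i + 1)).hom y = ev M z t := ⟨x, by rw [ht, hxy]⟩
      rw [ev, dif_pos hex]
      exact hex.choose_spec
    obtain ⟨n, hn, w, hw⟩ := hz i (x - ev M z (.c i (i + 1) t)) (by
      rw [map_sub, hc, ht, hxy, sub_self])
    obtain ⟨n, rfl⟩ := hspan i hn
    refine ⟨(Submodule.Quotient.mk (Finsupp.single (.c i (i + 1) t) 1 + n) :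
      (Term Λ i →₀ Λ) ⧸ LinearMap.ker (lev M z i)), w, ?_⟩
    rw [codeMap_mk, map_add, lev_single, add_assoc, ← hw]
    abel

end

theorem exists_gens (M : CochainComplex (ModuleCat.{0} Λ) ℤ) (i : ℤ)
    (hM : Module.Finite Λ (M.homology i)) : ∃ z : ℕ → M.X i, ∀ x : M.X i,
      (M.d i (i + 1)).hom x = 0 →
      ∃ n ∈ Submodule.span Λ (Set.range z), ∃ w : M.X (i - 1), x = n + (M.d (i - 1) i).hom w := by
  obtain ⟨m, s, hs⟩ := Module.Finite.exists_fin (R := Λ) (M := M.homology i)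
  have hπ : Function.Surjective (M.homologyπ i).hom := (ModuleCat.epi_iff_surjective _).1 inferInstance
  choose r hr using fun j => hπ (s j)
  let zc : ℕ → M.cycles i := fun j => if h : j < m then r ⟨j, h⟩ else 0
  have hzc : Submodule.map (M.homologyπ i).hom (Submodule.span Λ (Set.range zc)) = ⊤ := by
    rw [eq_top_iff, ← hs, Submodule.span_le]
    rintro _ ⟨j, rfl⟩
    exact ⟨zc j, Submodule.subset_span ⟨j, rfl⟩, by simp [zc, hr]⟩
  refine ⟨fun j => (M.iCycles i).hom (zc j), fun x hx => ?_⟩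
  have hk : ∃ x' : M.cycles i, (M.iCycles i).hom x' = x := by
    have := (ShortComplex.exact_of_f_is_kernel
      (ShortComplex.mk (M.iCycles i) (M.d i (i + 1)) (by simp)) (M.cyclesIsKernel i (i + 1) (by simp)))
    exact (ShortComplex.moduleCat_exact_iff _).1 this x hx
  obtain ⟨x', rfl⟩ := hk
  obtain ⟨n, hn, hn'⟩ : (M.homologyπ i).hom x' ∈
    Submodule.map (M.homologyπ i).hom (Submodule.span Λ (Set.range zc)) := by rw [hzc]; trivial
  have := (ShortComplex.exact_of_g_is_cokernel
    (ShortComplex.mk (M.toCycles (i - 1) i) (M.homologyπ i) (by simp)) (M.homologyIsCokernel (i - 1) i (by simp)))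
  obtain ⟨w, hw⟩ := (ShortComplex.moduleCat_exact_iff _).1 this (x' - n) (by
    change (M.homologyπ i).hom (x' - n) = 0
    rw [map_sub, hn', sub_self])
  refine ⟨(M.iCycles i).hom n, ?_, w, ?_⟩
  · have : (M.iCycles i).hom n ∈ Submodule.map (M.iCycles i).hom
      (Submodule.span Λ (Set.range zc)) := ⟨n, hn, rfl⟩
    rw [Submodule.map_span, ← Set.range_comp] at this
    exact this
  · have h1 : (M.d (i - 1) i).hom w = (M.iCycles i).hom ((M.toCycles (i - 1) i).hom w) := by
      have := congrArg (fun ψ => ψ.hom w) (M.toCycles_i (i - 1) i)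
      exact this.symm
    have h2 : (M.toCycles (i - 1) i).hom w = x' - n := hw
    rw [h1, h2, map_sub]
    abel

open DerivedCategory in
theorem exists_code [HasDerivedCategory.{w} (ModuleCat.{0} Λ)]
    (D : DerivedCategory (ModuleCat.{0} Λ))
    (hD : ∀ i : ℤ, Module.Finite Λ ((homologyFunctor (ModuleCat.{0} Λ) i).obj D)) :
    ∃ K : Code Λ, Nonempty (Q.obj K.cx ≅ D) := by
  let M := Q.objPreimage D
  let e : Q.obj M ≅ D := Q.objObjPreimageIso D
  have hM : ∀ i, Module.Finite Λ (M.homology i) := fun i => by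
    have e' : (homologyFunctor (ModuleCat.{0} Λ) i).obj D ≅ M.homology i :=
      (homologyFunctor (ModuleCat.{0} Λ) i).mapIso e.symm ≪≫
        (homologyFunctorFactors (ModuleCat.{0} Λ) i).app M
    have := hD i
    exact Module.Finite.equiv e'.toLinearEquiv
  choose z hz using fun i => exists_gens M i (hM i)
  have := codeMap_iso M z hz
  exact ⟨code M z, ⟨asIso (Q.map (codeMap M z)) ≪≫ e⟩⟩

end

end

end Paper
namespace Paper

variable {C : Type*} [Category C] [HasZeroObject C] [Preadditive C] [HasShift C ℤ]
  [∀ n : ℤ, (shiftFunctor C n).Additive] [Pretriangulated C]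

/-- The shift of a class of objects: `S⟦n⟧` (closed under isomorphism). -/
def shiftSet (S : Set C) (n : ℤ) : Set C := {X | ∃ A ∈ S, Nonempty (X ≅ A⟦n⟧)}

/-- `S[≤ n] = { S⟦i⟧ ∣ S ∈ S, i ≤ n }`. -/
def shiftsLe (S : Set C) (n : ℤ) : Set C := {X | ∃ A ∈ S, ∃ i : ℤ, i ≤ n ∧ Nonempty (X ≅ A⟦i⟧)}

/-- `S[≥ n] = { S⟦i⟧ ∣ S ∈ S, i ≥ n }`. -/
def shiftsGe (S : Set C) (n : ℤ) : Set C := {X | ∃ A ∈ S, ∃ i : ℤ, n ≤ i ∧ Nonempty (X ≅ A⟦i⟧)}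

/-- `X * Y`: objects `D` fitting in a distinguished triangle `X → D → Y → X⟦1⟧`. -/
def star (X Y : Set C) : Set C :=
  {D | ∃ (A B : C) (f : A ⟶ D) (g : D ⟶ B) (h : B ⟶ A⟦(1 : ℤ)⟧),
    A ∈ X ∧ B ∈ Y ∧ Triangle.mk f g h ∈ distTriang C}

/-- Right perpendicular class. -/
def rightPerp (S : Set C) : Set C := {D | ∀ A ∈ S, ∀ f : A ⟶ D, f = 0}

/-- Left perpendicular class. -/
def leftPerp (S : Set C) : Set C := {D | ∀ B ∈ S, ∀ f : D ⟶ B, f = 0}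

/-- A t-structure `(X, Y)` on a (pre)triangulated category. -/
structure IsTStructure (X Y : Set C) : Prop where
  rp : rightPerp X = Y
  lp : leftPerp Y = X
  dec : ∀ D : C, D ∈ star X Y
  shift : shiftSet X 1 ⊆ X

/-- The heart `H = X ∩ Y⟦1⟧` of a t-structure. -/
def heart (X Y : Set C) : Set C := X ∩ shiftSet Y 1

/-- The extension closure of a class of objects. -/
inductive ExtClosure (S : Set C) : C → Prop
  | of {A : C} (h : A ∈ S) : ExtClosure S A
  | iso {A B : C} (e : A ≅ B) (h : ExtClosure S A) : ExtClosure S B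
  | ext {A E B : C} (f : A ⟶ E) (g : E ⟶ B) (h : B ⟶ A⟦(1 : ℤ)⟧)
      (hT : Triangle.mk f g h ∈ distTriang C)
      (hA : ExtClosure S A) (hB : ExtClosure S B) : ExtClosure S E

/-- The extension closure, as a set. -/
def extClosure (S : Set C) : Set C := {X | ExtClosure S X}

/-- A torsion pair `(T, F)` in the heart of a t-structure `(X, Y)`; short exact sequences in
the heart correspond to distinguished triangles with three terms in the heart. -/
structure IsHeartTorsionPair (X Y T F : Set C) : Prop where
  subT : T ⊆ heart X Y
  subF : F ⊆ heart X Y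
  rp : heart X Y ∩ rightPerp T = F
  lp : heart X Y ∩ leftPerp F = T
  dec : ∀ H₀ ∈ heart X Y, H₀ ∈ star T F

/-- A bounded t-structure. -/
def IsBounded (X Y : Set C) : Prop :=
  (∀ D : C, ∃ n : ℤ, D ∈ shiftSet X n) ∧ (∀ D : C, ∃ n : ℤ, D ∈ shiftSet Y n)

/-- A simple object of the heart of a t-structure: a nonzero object admitting no proper
subobjects in the heart (expressed via distinguished triangles with entries in the heart). -/
def IsSimpleInHeart (X Y : Set C) (A : C) : Prop :=
  A ∈ heart X Y ∧ ¬ IsZero A ∧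
  ∀ (A' B : C) (f : A' ⟶ A) (g : A ⟶ B) (h : B ⟶ A'⟦(1 : ℤ)⟧),
    Triangle.mk f g h ∈ (distTriang C) → A' ∈ heart X Y → B ∈ heart X Y →
    IsZero A' ∨ IsZero B

/-- An algebraic t-structure: a bounded t-structure whose heart is a length category with
finitely many simple objects, i.e. the heart is the extension closure of finitely many
simple objects. -/
def IsAlgebraic (X Y : Set C) : Prop :=
  IsTStructure X Y ∧ IsBounded X Y ∧
  ∃ (t : ℕ) (G : Fin t → C), (∀ i, IsSimpleInHeart X Y (G i)) ∧
    heart X Y = extClosure (Set.range G)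

/-- Thick closure: the smallest triangulated subcategory closed under direct summands. -/
inductive ThickClosure (S : Set C) : C → Prop
  | of {A : C} (h : A ∈ S) : ThickClosure S A
  | iso {A B : C} (e : A ≅ B) (h : ThickClosure S A) : ThickClosure S B
  | shift {A : C} (n : ℤ) (h : ThickClosure S A) : ThickClosure S (A⟦n⟧)
  | ext {A E B : C} (f : A ⟶ E) (g : E ⟶ B) (h : B ⟶ A⟦(1 : ℤ)⟧)
      (hT : Triangle.mk f g h ∈ distTriang C)
      (hA : ThickClosure S A) (hB : ThickClosure S B) : ThickClosure S E
  | retract {A B : C} (s : A ⟶ B) (r : B ⟶ A) (hsr : s ≫ r = 𝟙 A)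
      (h : ThickClosure S B) : ThickClosure S A

/-- Thick closure, as a set. -/
def thickClosure (S : Set C) : Set C := {X | ThickClosure S X}

/-- `Hom(S, T⟦i⟧) = 0` for all `i > 0`. -/
def vanishHomPos (S T : Set C) : Prop :=
  ∀ A ∈ S, ∀ B ∈ T, ∀ i : ℤ, 0 < i → ∀ f : A ⟶ B⟦i⟧, f = 0

/-- A silting subcategory `S` of the (thick) subcategory `P`. -/
def IsSiltingIn (P S : Set C) : Prop :=
  S ⊆ P ∧ thickClosure S = P ∧ vanishHomPos S S

/-- The aisle `X_S = (S[≤ 0])^⊥` of the t-structure associated to a silting subcategory. -/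
def siltXs (S : Set C) : Set C := rightPerp (shiftsLe S 0)

/-- The coaisle `Y_S = (S[≥ 0])^⊥` of the t-structure associated to a silting subcategory. -/
def siltYs (S : Set C) : Set C := rightPerp (shiftsGe S 0)

/-- A class of objects closed under isomorphisms, finite direct sums and direct summands. -/
def IsAddClosed [HasBinaryBiproducts C] (S : Set C) : Prop :=
  (∀ A B : C, (A ≅ B) → A ∈ S → B ∈ S) ∧
  (∀ A B : C, A ∈ S → B ∈ S → (A ⊞ B) ∈ S) ∧
  (∀ A B : C, (∃ (s : A ⟶ B) (r : B ⟶ A), s ≫ r = 𝟙 A) → B ∈ S → A ∈ S)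

/-- Silting-discreteness (relative to the subcategory `P` of compact objects, e.g.
`K^b(proj Λ)`): for every silting subcategory `S` of `P` there are only finitely many silting
subcategories `T` with `S ≥ T ≥ S⟦1⟧`. -/
def IsSiltingDiscrete [HasBinaryBiproducts C] (P : Set C) : Prop :=
  ∀ S : Set C, IsSiltingIn P S → IsAddClosed S →
    {T : Set C | IsSiltingIn P T ∧ IsAddClosed T ∧
      vanishHomPos S T ∧ vanishHomPos T (shiftSet S 1)}.Finite

/-- A t-structure on a full (pre)triangulated subcategory `B` of the ambient category. -/
structure IsTStructureOn (B X Y : Set C) : Prop where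
  subX : X ⊆ B
  subY : Y ⊆ B
  rp : B ∩ rightPerp X = Y
  lp : B ∩ leftPerp Y = X
  dec : ∀ D ∈ B, D ∈ star X Y
  shift : shiftSet X 1 ⊆ X

section Derived

variable (k : Type) [Field k] (Λ : Type) [Ring Λ] [Algebra k Λ] [FiniteDimensional k Λ]
  [HasDerivedCategory (ModuleCat.{0} Λ)]

/-- The bounded derived category `D^b(Λ)` of the finite-dimensional algebra `Λ`, realised as
the full subcategory of the unbounded derived category `D(Λ)` consisting of complexes with
bounded, finitely generated cohomology. -/
def boundedDb : Set (DerivedCategory (ModuleCat.{0} Λ)) :=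
  {X | (∃ a b : ℤ, ∀ i : ℤ, (i < a ∨ b < i) →
          IsZero ((DerivedCategory.homologyFunctor (ModuleCat.{0} Λ) i).obj X)) ∧
       ∀ i : ℤ, Module.Finite Λ ((DerivedCategory.homologyFunctor (ModuleCat.{0} Λ) i).obj X)}

theorem tri_iso (T : Triangle C) (hT : T ∈ distTriang C) {D : C} (e : T.obj₂ ≅ D) :
    Triangle.mk (T.mor₁ ≫ e.hom) (e.inv ≫ T.mor₂) T.mor₃ ∈ distTriang C := by
  refine isomorphic_distinguished _ hT _ ?_
  refine Triangle.isoMk _ _ (Iso.refl T.obj₁) e.symm (Iso.refl T.obj₃) ?_ ?_ ?_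
  · change (T.mor₁ ≫ e.hom) ≫ e.inv = 𝟙 _ ≫ T.mor₁
    simp
  · change (e.inv ≫ T.mor₂) ≫ 𝟙 _ = e.inv ≫ T.mor₂
    simp
  · change T.mor₃ ≫ (𝟙 T.obj₁)⟦(1 : ℤ)⟧' = 𝟙 _ ≫ T.mor₃
    simp

section Main
open DerivedCategory

theorem tstr_dec {Λ : Type} [Ring Λ] [HasDerivedCategory (ModuleCat.{0} Λ)]
    (X : Set (DerivedCategory (ModuleCat.{0} Λ))) (hX : X ⊆ boundedDb Λ)
    (hiso : ∀ A B : DerivedCategory (ModuleCat.{0} Λ), Nonempty (A ≅ B) → A ∈ X → B ∈ X)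
    (D : DerivedCategory (ModuleCat.{0} Λ)) :
    D ∈ star (leftPerp (rightPerp X)) (rightPerp X) := by
  choose R hR hR' using fun K : Code Λ => kproj_res K.cx
  obtain ⟨S, hS, hS1, h1, h2⟩ := thmA.{0}
    (fun t : {K : Code Λ // Q.obj K.cx ∈ X} => R t.1) (Q.objPreimage D)
  let e : Q.obj S.X₁ ≅ D := Q.mapIso (eqToIso hS1) ≪≫ Q.objObjPreimageIso D
  have hT := triangleOfSES_distinguished hS
  have hT' := inv_rot_of_distTriang _ hT
  let T := (triangleOfSES hS).invRotate
  have hT2 := tri_iso T hT' (D := D) e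
  refine ⟨_, _, _, _, _, ?_, ?_, hT2⟩
  · intro B hB f
    change (Q.obj S.X₃)⟦(-1 : ℤ)⟧ ⟶ B at f
    let u : (Q.obj S.X₃) ⟶ B⟦(1 : ℤ)⟧ :=
      (shiftFunctorCompIsoId (DerivedCategory (ModuleCat.{0} Λ)) (-1 : ℤ) 1 (by simp)).inv.app _ ≫ f⟦(1 : ℤ)⟧'
    have hu : u = 0 := by
      let L := Q.objPreimage (B⟦(1 : ℤ)⟧)
      let eL : Q.obj L ≅ B⟦(1 : ℤ)⟧ := Q.objObjPreimageIso _
      obtain ⟨L', g, s, hs, hgs⟩ := left_fac (u ≫ eL.inv)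
      have eB : Q.obj (L'⟦(-1 : ℤ)⟧) ≅ B :=
        (Q.commShiftIso (-1 : ℤ)).app L' ≪≫ (CategoryTheory.shiftFunctor _ (-1 : ℤ)).mapIso
          ((asIso (Q.map s)).symm ≪≫ eL) ≪≫
          (shiftFunctorCompIsoId _ (1 : ℤ) (-1) (by simp)).app _
      obtain ⟨H⟩ := homotopy_of_pr (h2 (L'⟦(-1 : ℤ)⟧) (by
        intro t p
        have := hR t.1
        apply Q_kproj_inj
        obtain ⟨et⟩ := hR' t.1
        have := hB _ t.2 (et.inv ≫ Q.map p ≫ eB.hom)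
        rw [← cancel_epi et.inv, ← cancel_mono eB.hom]
        simpa using this)) g
      have hg : Q.map g = 0 := by rw [Q_map_eq_of_homotopy _ H, Functor.map_zero]
      rw [← cancel_mono eL.inv, hgs, hg]
      simp
    have : f⟦(1 : ℤ)⟧' = 0 := by
      rw [← cancel_epi ((shiftFunctorCompIsoId (DerivedCategory (ModuleCat.{0} Λ)) (-1 : ℤ) 1
        (by simp)).inv.app _)]
      exact hu.trans comp_zero.symm
    exact (CategoryTheory.shiftFunctor _ (1 : ℤ)).map_injective (this.trans (Functor.map_zero _ _ _).symm)
  · intro A hA f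
    change A ⟶ Q.obj S.X₂ at f
    obtain ⟨K, ⟨eK⟩⟩ := exists_code A (hX hA).2
    obtain ⟨eR⟩ := hR' K
    have := hR K
    obtain ⟨p, hp⟩ := Q_kproj_surj ((eR ≪≫ eK).hom ≫ f)
    have h0 := Q_nul (h1 ⟨K, hiso _ _ ⟨eK.symm⟩ hA⟩ p)
    exact (cancel_epi (eR ≪≫ eK).hom).1 ((hp.symm.trans h0).trans comp_zero.symm)

theorem main9 {Λ : Type} [Ring Λ] [HasDerivedCategory (ModuleCat.{0} Λ)]
    (X Y : Set (DerivedCategory (ModuleCat.{0} Λ)))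
    (h : IsTStructureOn (boundedDb Λ) X Y) :
    IsTStructure (leftPerp (rightPerp X)) (rightPerp X) ∧
    leftPerp (rightPerp X) ∩ boundedDb Λ = X ∧
    rightPerp X ∩ boundedDb Λ = Y := by
  have hXl : X ⊆ leftPerp (rightPerp X) := fun A hA B hB f => hB A hA f
  have hYr : Y ⊆ rightPerp X := by
    rw [← h.rp]; exact Set.inter_subset_right
  have hiso : ∀ A B : DerivedCategory (ModuleCat.{0} Λ), Nonempty (A ≅ B) → A ∈ X → B ∈ X := by
    rintro A B ⟨e⟩ hA
    have hA' := h.lp ▸ hA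
    rw [← h.lp]
    obtain ⟨⟨⟨a, b, hab⟩, hf⟩, hl⟩ := hA'
    refine ⟨⟨⟨a, b, fun i hi => (hab i hi).of_iso ((homologyFunctor _ i).mapIso e.symm)⟩,
      fun i => ?_⟩, fun C hC f => ?_⟩
    · have := hf i
      exact Module.Finite.equiv ((homologyFunctor (ModuleCat.{0} Λ) i).mapIso e).toLinearEquiv
    · rw [← cancel_epi e.hom, hl C hC (e.hom ≫ f), comp_zero]
  refine ⟨⟨?_, rfl, tstr_dec X h.subX hiso, ?_⟩, ?_, ?_⟩
  · apply Set.Subset.antisymm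
    · exact fun B hB A hA f => hB A (hXl hA) f
    · exact fun B hB A hA f => hA B hB f
  · rintro A ⟨B, hB, ⟨e⟩⟩ C hC f
    let u : B ⟶ C⟦(-1 : ℤ)⟧ :=
      (shiftFunctorCompIsoId (DerivedCategory (ModuleCat.{0} Λ)) (1 : ℤ) (-1) (by simp)).inv.app _ ≫
        (e.inv ≫ f)⟦(-1 : ℤ)⟧'
    have hu : u = 0 := by
      refine hB _ (fun Z hZ g => ?_) u
      apply (CategoryTheory.shiftFunctor _ (1 : ℤ)).map_injective
      rw [Functor.map_zero]
      have := hC (Z⟦(1 : ℤ)⟧) (h.shift ⟨Z, hZ, ⟨Iso.refl _⟩⟩) (g⟦(1 : ℤ)⟧' ≫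
        (shiftFunctorCompIsoId (DerivedCategory (ModuleCat.{0} Λ)) (-1 : ℤ) 1 (by simp)).hom.app _)
      rw [← cancel_mono ((shiftFunctorCompIsoId (DerivedCategory (ModuleCat.{0} Λ)) (-1 : ℤ) 1
        (by simp)).hom.app C)]
      exact this.trans zero_comp.symm
    have h0 : (e.inv ≫ f)⟦(-1 : ℤ)⟧' = 0 := by
      rw [← cancel_epi ((shiftFunctorCompIsoId (DerivedCategory (ModuleCat.{0} Λ)) (1 : ℤ) (-1)
        (by simp)).inv.app _)]
      exact hu.trans comp_zero.symm
    have h00 : e.inv ≫ f = 0 :=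
      (CategoryTheory.shiftFunctor _ (-1 : ℤ)).map_injective (h0.trans (Functor.map_zero _ _ _).symm)
    rw [← cancel_epi e.inv, h00, comp_zero]
  · apply Set.Subset.antisymm
    · rintro A ⟨hA, hB⟩
      rw [← h.lp]
      exact ⟨hB, fun C hC f => hA C (hYr hC) f⟩
    · exact fun A hA => ⟨hXl hA, h.subX hA⟩
  · rw [Set.inter_comm]
    exact h.rp

end Main

/-- Lemma 10, first part; Saorín–Stovicek: For any t-structure `(X, Y)` on the
(essentially small) bounded derived category `D^b(Λ) ⊆ D(Λ)`, the pair
`(X̃, Ỹ) = (^⊥(X^⊥), X^⊥)`, with orthogonals computed in `D(Λ)`, is a t-structure on `D(Λ)`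
which restricts to `(X, Y)` on `D^b(Λ)`. -/
theorem statement9
    (X Y : Set (DerivedCategory (ModuleCat.{0} Λ)))
    (h : IsTStructureOn (boundedDb Λ) X Y) :
    IsTStructure (leftPerp (rightPerp X)) (rightPerp X) ∧
    leftPerp (rightPerp X) ∩ boundedDb Λ = X ∧
    rightPerp X ∩ boundedDb Λ = Y := by
  exact main9 X Y h

end Derived

end Paper
end

section
/- Let H be a length abelian category (every object has finite composition length) and Z: K_0(H) → ℂ a stability function, i.e. Z(H) ∈ {r·exp(iπφ) : r > 0, 0 < φ ≤ 1} for every nonzero H ∈ H. Then Z satisfies the Harder–Narasimhan property: every nonzero object H ∈ H admits a finite filtration 0 = H_0 ⊂ H_1 ⊂ ... ⊂ H_n = H whose factors H_i/H_{i-1} are Z-semistable with strictly decreasing phases φ(Z(H_1/H_0)) > ... > φ(Z(H_n/H_{n-1})). -/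
open CategoryTheory Category Limits

namespace Paper

lemma arg_lt_iff_cross {z w : ℂ} (hz : 0 < z.arg) (hw : 0 < w.arg) :
    z.arg < w.arg ↔ 0 < z.re * w.im - z.im * w.re := by
  have hz0 : z ≠ 0 := by rintro rfl; simp at hz
  have hw0 : w ≠ 0 := by rintro rfl; simp at hw
  have e : z.re * w.im - z.im * w.re = ‖z‖ * ‖w‖ * Real.sin (w.arg - z.arg) := by
    rw [Real.sin_sub, ← Complex.norm_mul_cos_arg z, ← Complex.norm_mul_cos_arg w,
      ← Complex.norm_mul_sin_arg z, ← Complex.norm_mul_sin_arg w]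
    ring
  have hp : 0 < ‖z‖ * ‖w‖ := mul_pos (norm_pos_iff.2 hz0) (norm_pos_iff.2 hw0)
  rw [e, mul_pos_iff_of_pos_left hp]
  have h1 := Complex.arg_le_pi z
  have h2 := Complex.arg_le_pi w
  constructor
  · intro h
    exact Real.sin_pos_of_pos_of_lt_pi (by linarith) (by linarith)
  · intro h
    by_contra h'
    have := Real.sin_nonpos_of_nonpos_of_neg_pi_le (x := w.arg - z.arg) (by linarith) (by linarith)
    linarith

section lat
variable {L : Type*} [Lattice L] (v : L → ℂ)

noncomputable def ph (a b : L) : ℝ := (v b - v a).arg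

variable {v} (hv : ∀ a b : L, a < b → 0 < ph v a b)
include hv

lemma S1 {a b c : L} (h : a < b) (h' : b < c) : ph v a b < ph v a c ↔ ph v a b < ph v b c := by
  have h1 := hv _ _ h
  have h2 := hv _ _ h'
  have h3 := hv _ _ (h.trans h')
  unfold ph at *
  rw [arg_lt_iff_cross h1 h2, arg_lt_iff_cross h1 h3]
  simp only [Complex.sub_re, Complex.sub_im]
  ring_nf

lemma S2 {a b c : L} (h : a < b) (h' : b < c) : ph v a c < ph v b c ↔ ph v a b < ph v b c := by
  have h1 := hv _ _ h
  have h2 := hv _ _ h'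
  have h3 := hv _ _ (h.trans h')
  unfold ph at *
  rw [arg_lt_iff_cross h1 h2, arg_lt_iff_cross h3 h2]
  simp only [Complex.sub_re, Complex.sub_im]
  ring_nf

lemma S3 {a b c : L} (h : a < b) (h' : b < c) : ph v a c < ph v a b ↔ ph v b c < ph v a b := by
  have h1 := hv _ _ h
  have h2 := hv _ _ h'
  have h3 := hv _ _ (h.trans h')
  unfold ph at *
  rw [arg_lt_iff_cross h2 h1, arg_lt_iff_cross h3 h1]
  simp only [Complex.sub_re, Complex.sub_im]
  ring_nf

lemma S4 {a b c : L} (h : a < b) (h' : b < c) : ph v b c < ph v a c ↔ ph v b c < ph v a b := by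
  have h1 := hv _ _ h
  have h2 := hv _ _ h'
  have h3 := hv _ _ (h.trans h')
  unfold ph at *
  rw [arg_lt_iff_cross h2 h1, arg_lt_iff_cross h2 h3]
  simp only [Complex.sub_re, Complex.sub_im]
  ring_nf

lemma exists_mdq [WellFoundedLT L] [WellFoundedGT L]
    (hm : ∀ a b : L, v (a ⊔ b) + v (a ⊓ b) = v a + v b) (b : L) (a : L) : a < b →
    ∃ k, a ≤ k ∧ k < b ∧ ∀ l, a ≤ l → l < b → ph v k b ≤ ph v l b ∧
      (ph v l b ≤ ph v k b → k ≤ l) := by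
  induction a using WellFoundedGT.induction with
  | ind a ih =>
  intro hab
  by_cases hss : ∀ l, a ≤ l → l < b → ph v a b ≤ ph v l b
  · exact ⟨a, le_rfl, hab, fun l h1 h2 => ⟨hss l h1 h2, fun _ => h1⟩⟩
  push Not at hss
  obtain ⟨c, ⟨hac, hcb, hc⟩, hmin⟩ := wellFounded_lt.has_min
    {l : L | a ≤ l ∧ l < b ∧ ph v l b < ph v a b} hss
  have hac : a < c := lt_of_le_of_ne hac (by rintro rfl; exact lt_irrefl _ hc)
  have hc2 : ph v a b < ph v a c := by
    have := (S4 hv hac hcb).1 hc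
    exact (S3 hv hac hcb).2 this |>.trans_le le_rfl
  obtain ⟨k, hck, hkb, hk⟩ := ih c hac hcb
  have hkc := (hk c le_rfl hcb).1
  refine ⟨k, hac.le.trans hck, hkb, fun l hal hlb => ?_⟩
  by_cases hcl : c ≤ l
  · exact hk l hcl hlb
  suffices h : ph v k b < ph v l b from ⟨h.le, fun h' => absurd h (not_lt.2 h')⟩
  have hx : l ⊓ c < c := lt_of_le_of_ne inf_le_right (fun h => hcl (inf_eq_right.1 h))
  have hy : l < l ⊔ c := lt_of_le_of_ne le_sup_left (fun h => hcl (sup_eq_left.1 h.symm))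
  have hax : a ≤ l ⊓ c := le_inf hal hac.le
  have e : ph v (l ⊓ c) c = ph v l (l ⊔ c) := by
    unfold ph
    congr 1
    linear_combination -(hm l c)
  have h1 : ph v a b < ph v l (l ⊔ c) := by
    rw [← e]
    rcases hax.eq_or_lt with h | h
    · rwa [← h]
    · have h2 : ph v a b ≤ ph v (l ⊓ c) b := by
        by_contra h3
        exact hmin _ ⟨hax, hx.trans hcb, not_le.1 h3⟩ hx
      have h3 : ph v a (l ⊓ c) ≤ ph v a b := by
        have h4 := S3 hv h (hx.trans hcb)
        have h5 := S4 hv h (hx.trans hcb)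
        by_contra h6
        have := h5.2 (h4.1 (not_le.1 h6))
        linarith
      have := (S1 hv h hx).1 (by linarith)
      have := (S2 hv h hx).2 this
      linarith
  have hle : l ⊔ c ≤ b := sup_le hlb.le hcb.le
  rcases hle.eq_or_lt with h | h
  · rw [h] at h1; linarith
  · have h2 := (hk _ le_sup_right h).1
    rcases lt_or_ge (ph v (l ⊔ c) b) (ph v l (l ⊔ c)) with h3 | h3
    · have := (S4 hv hy h).2 h3
      linarith
    · have : ph v l (l ⊔ c) ≤ ph v l b := by
        by_contra h6
        have := (S3 hv hy h).1 (not_le.1 h6)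
        linarith
      linarith

lemma exists_HN [WellFoundedLT L] [WellFoundedGT L]
    (hm : ∀ a b : L, v (a ⊔ b) + v (a ⊓ b) = v a + v b) (a : L) (b : L) : a < b →
    ∃ (n : ℕ) (c : ℕ → L), c 0 = a ∧ c (n + 1) = b ∧
      (∀ i ≤ n, c i < c (i + 1) ∧ ∀ l, c i < l → l ≤ c (i + 1) →
        ph v (c i) l ≤ ph v (c i) (c (i + 1))) ∧
      ∀ i < n, ph v (c (i + 1)) (c (i + 2)) < ph v (c i) (c (i + 1)) := by
  induction b using WellFoundedLT.induction with
  | ind b ih =>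
  intro hab
  obtain ⟨k, hak, hkb, hk⟩ := exists_mdq hv hm b a hab
  have hss : ∀ l, k < l → l ≤ b → ph v k l ≤ ph v k b := by
    intro l hl hlb
    rcases hlb.eq_or_lt with rfl | h
    · exact le_rfl
    have := (hk l (hak.trans hl.le) h).1
    by_contra h6
    have := (S4 hv hl h).2 ((S3 hv hl h).1 (not_le.1 h6))
    linarith
  rcases hak.eq_or_lt with rfl | hak'
  · refine ⟨0, fun i => if i = 0 then a else b, by simp, by simp, ?_, by simp⟩
    intro i hi
    obtain rfl : i = 0 := by omega
    simpa using ⟨hkb, hss⟩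
  · obtain ⟨n, c, h0, hn, h1, h2⟩ := ih k hkb hak'
    refine ⟨n + 1, fun i => if i ≤ n + 1 then c i else b, by simpa, by simp, ?_, ?_⟩
    · intro i hi
      rcases hi.eq_or_lt with rfl | hi'
      · simpa [hn] using ⟨hkb, hss⟩
      · have := h1 i (by omega)
        simpa [hi, show i ≤ n by omega] using this
    · intro i hi
      rcases (Nat.lt_succ_iff.1 hi).eq_or_lt with rfl | hi'
      · simp only [le_add_iff_nonneg_right, zero_le, if_true, le_refl, hn]
        have hlt := (h1 i le_rfl).1
        rw [hn] at hlt
        have hac : a ≤ c i := by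
          have : ∀ j ≤ i + 1, a ≤ c j := by
            intro j
            induction j with
            | zero => intro _; exact h0.ge
            | succ j ihj =>
              intro hj
              exact (ihj (by omega)).trans (h1 j (by omega)).1.le
          exact this i (by omega)
        have h3 : ph v k b < ph v (c i) b := by
          by_contra h
          exact absurd ((hk _ hac (hlt.trans hkb)).2 (not_lt.1 h)) (not_le_of_gt hlt)
        have := (S4 hv hlt hkb).1 h3
        simpa using this
      · have := h2 i hi'
        simpa [show i ≤ n + 1 by omega, show i + 1 ≤ n + 1 by omega, show i + 2 ≤ n + 1 by omega,
          show i ≤ n by omega, show i + 1 ≤ n by omega] using this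

end lat

section cat
variable {H : Type*} [Category H] [Abelian H]

lemma sup_inf_shortExact {X : H} (A B : Subobject X) :
    ∃ S : ShortComplex H, S.ShortExact ∧ S.X₁ = ((A ⊓ B : Subobject X) : H) ∧
      S.X₂ = ((A : H) ⊞ (B : H)) ∧ S.X₃ = ((A ⊔ B : Subobject X) : H) := by
  let iA := Subobject.ofLE (A ⊓ B) A inf_le_left
  let iB := Subobject.ofLE (A ⊓ B) B inf_le_right
  let jA := Subobject.ofLE A (A ⊔ B) le_sup_left
  let jB := Subobject.ofLE B (A ⊔ B) le_sup_right
  let i := biprod.lift iA (-iB)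
  let p := biprod.desc jA jB
  have w : i ≫ p = 0 := by
    simp [i, p, iA, iB, jA, jB, biprod.lift_desc, Subobject.ofLE_comp_ofLE]
  have hmono : Mono i := by
    have : i ≫ biprod.fst = iA := by simp [i]
    exact mono_of_mono_fac this
  have hepi : Epi p := by
    refine Preadditive.epi_of_cancel_zero _ fun {W} h hh => ?_
    have hA : jA ≫ h = 0 := by
      have := congrArg (fun t => biprod.inl ≫ t) hh
      simpa [p] using this
    have hB : jB ≫ h = 0 := by
      have := congrArg (fun t => biprod.inr ≫ t) hh
      simpa [p] using this
    let K : Subobject X := Subobject.mk (kernel.ι h ≫ (A ⊔ B).arrow)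
    have hAK : A ≤ K := Subobject.le_mk_of_comm (kernel.lift h jA hA) (by simp [jA])
    have hBK : B ≤ K := Subobject.le_mk_of_comm (kernel.lift h jB hB) (by simp [jB])
    have hK : A ⊔ B ≤ K := sup_le hAK hBK
    have e : Subobject.ofLEMk _ _ hK ≫ kernel.ι h = 𝟙 _ := by
      rw [← cancel_mono (A ⊔ B).arrow]
      simp [K]
    rw [← Category.id_comp h, ← e, Category.assoc, kernel.condition, comp_zero]
  refine ⟨ShortComplex.mk i p w, ?_, rfl, rfl, rfl⟩
  refine ShortComplex.ShortExact.mk' ?_ hmono hepi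
  refine ShortComplex.exact_of_f_is_kernel _ ?_
  refine KernelFork.IsLimit.ofι' _ _ fun {W} k hk => ?_
  have hk' : k ≫ biprod.fst ≫ A.arrow + k ≫ biprod.snd ≫ B.arrow = 0 := by
    have := congrArg (fun t => t ≫ (A ⊔ B).arrow) hk
    simpa [p, biprod.desc_eq, jA, jB] using this
  have hfac : (A ⊓ B).Factors (k ≫ biprod.fst ≫ A.arrow) := by
    rw [Subobject.inf_factors]
    refine ⟨?_, ?_⟩
    · rw [← Category.assoc]; exact Subobject.factors_comp_arrow _
    · rw [eq_neg_of_add_eq_zero_left hk', ← Category.assoc, ← Preadditive.neg_comp]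
      exact Subobject.factors_comp_arrow _
  refine ⟨(A ⊓ B).factorThru _ hfac, ?_⟩
  apply biprod.hom_ext
  · rw [← cancel_mono A.arrow]
    simp [i, iA]
  · rw [← cancel_mono B.arrow]
    simp [i, iB]
    rw [eq_neg_of_add_eq_zero_left hk', neg_neg]

variable {Z : H → ℂ}
    (hadd : ∀ S : ShortComplex H, S.ShortExact → Z S.X₂ = Z S.X₁ + Z S.X₃)
include hadd

lemma Z_coker {A B : H} (f : A ⟶ B) [Mono f] : Z B = Z A + Z (cokernel f) :=
  hadd (ShortComplex.mk f (cokernel.π f) (by simp))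
    (.mk' (ShortComplex.exact_cokernel f) inferInstance inferInstance)

lemma Z_ker {A B : H} (f : A ⟶ B) [Epi f] : Z A = Z (kernel f) + Z B :=
  hadd (ShortComplex.mk (kernel.ι f) f (by simp))
    (.mk' (ShortComplex.exact_kernel f) inferInstance inferInstance)

lemma Z_zero {A : H} (hA : IsZero A) : Z A = 0 := by
  have h := hadd (ShortComplex.mk (0 : A ⟶ A) (0 : A ⟶ A) (by simp))
    (.mk' (ShortComplex.exact_of_isZero_X₂ _ hA) ⟨fun _ _ _ => hA.eq_of_tgt _ _⟩ ⟨fun _ _ _ => hA.eq_of_src _ _⟩)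
  simpa using h

lemma Z_iso {A B : H} (e : A ≅ B) : Z A = Z B := by
  have h := Z_coker hadd e.hom
  rw [Z_zero hadd (isZero_cokernel_of_epi e.hom)] at h
  simpa using h.symm

lemma Z_modular {X : H} (A B : Subobject X) :
    Z ((A ⊔ B : Subobject X) : H) + Z ((A ⊓ B : Subobject X) : H) = Z (A : H) + Z (B : H) := by
  obtain ⟨S, hS, h1, h2, h3⟩ := sup_inf_shortExact A B
  have h := hadd S hS
  rw [h1, h2, h3] at h
  have h' := hadd _ (ShortComplex.Splitting.ofHasBinaryBiproduct (A : H) (B : H)).shortExact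
  simp at h'
  rw [h'] at h
  rw [h, add_comm]

end cat

/-- Let `H` be a length abelian category (every object is artinian and
noetherian, i.e. the subobject lattices satisfy both chain conditions) and let
`Z : K₀(H) → ℂ` be a stability function; we encode `Z` as an assignment on objects which is
additive on short exact sequences (hence factors through `K₀(H)`) such that `Z X` lies in
`ℍ = {r exp(iπφ) : r > 0, 0 < φ ≤ 1}` for every nonzero `X`, i.e. `0 < arg (Z X)`
(note `arg` takes values in `(-π, π]`, so this says exactly `Z X ∈ ℍ`; the phase
`φ = arg/π ∈ (0, 1]`, and comparing phases is the same as comparing `arg`).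
Then `Z` has the Harder–Narasimhan property: every nonzero object `X` has a finite filtration
`0 = H₀ ⊂ H₁ ⊂ ⋯ ⊂ Hₙ = X` whose factors `Qᵢ = Hᵢ₊₁/Hᵢ` are `Z`-semistable of strictly
decreasing phase. -/
theorem statement14 {H : Type*} [Category H] [Abelian H]
    [∀ X : H, WellFoundedLT (Subobject X)] [∀ X : H, WellFoundedGT (Subobject X)]
    (Z : H → ℂ)
    (hadd : ∀ S : ShortComplex H, S.ShortExact → Z S.X₂ = Z S.X₁ + Z S.X₃)
    (hstab : ∀ X : H, ¬ IsZero X → 0 < (Z X).arg) :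
    ∀ X : H, ¬ IsZero X →
      ∃ (n : ℕ) (_ : 0 < n) (obj : Fin (n + 1) → H)
        (f : ∀ i : Fin n, obj i.castSucc ⟶ obj i.succ)
        (Q : Fin n → H) (g : ∀ i : Fin n, obj i.succ ⟶ Q i),
        IsZero (obj 0) ∧ Nonempty (obj (Fin.last n) ≅ X) ∧
        (∀ i : Fin n, Mono (f i)) ∧
        (∀ i : Fin n, ∃ w : f i ≫ g i = 0, (ShortComplex.mk (f i) (g i) w).ShortExact) ∧
        (∀ i : Fin n, ¬ IsZero (Q i) ∧
          ∀ (A : H) (m : A ⟶ Q i), Mono m → ¬ IsZero A → (Z A).arg ≤ (Z (Q i)).arg) ∧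
        (∀ i j : Fin n, i < j → (Z (Q j)).arg < (Z (Q i)).arg) := by
  intro X hX
  have hv : ∀ a b : Subobject X, a < b → 0 < ph (fun S : Subobject X => Z (S : H)) a b := by
    intro a b hab
    have h := Z_coker hadd (Subobject.ofLE a b hab.le)
    have h2 := hstab (cokernel (Subobject.ofLE a b hab.le)) (by
      intro hz
      have : Epi (Subobject.ofLE a b hab.le) := Preadditive.epi_of_isZero_cokernel _ hz
      have : IsIso (Subobject.ofLE a b hab.le) := isIso_of_mono_of_epi _
      refine not_le_of_gt hab (Subobject.le_of_comm (inv (Subobject.ofLE a b hab.le)) ?_)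
      rw [IsIso.inv_comp_eq, Subobject.ofLE_arrow])
    simp only [ph, h]
    simpa using h2
  have hbt : (⊥ : Subobject X) < ⊤ := by
    refine lt_of_le_of_ne bot_le fun h => hX ?_
    have e : ((⊥ : Subobject X) : H) ≅ X :=
      Subobject.isoOfEq _ _ h ≪≫ asIso (⊤ : Subobject X).arrow
    exact ((isZero_zero H).of_iso Subobject.botCoeIsoZero).of_iso e.symm
  obtain ⟨n, c, h0, hn, hc, hd⟩ := exists_HN hv (fun a b => Z_modular hadd a b) ⊥ ⊤ hbt
  have hle : ∀ i : Fin (n + 1), c i ≤ c (i + 1) := fun i => (hc i (by omega)).1.le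
  have hQ : ∀ i : Fin (n + 1), Z (cokernel (Subobject.ofLE _ _ (hle i)))
      = Z (c (i + 1) : H) - Z (c i : H) := by
    intro i
    rw [Z_coker hadd (Subobject.ofLE _ _ (hle i))]
    ring
  have hph : ∀ i : Fin (n + 1), (Z (cokernel (Subobject.ofLE _ _ (hle i)))).arg =
      ph (fun S : Subobject X => Z (S : H)) (c i) (c (i + 1)) := by
    intro i
    rw [hQ, ph]
  refine ⟨n + 1, by omega, fun i => (c i : H), fun i => Subobject.ofLE _ _ (hle i),
    fun i => cokernel (Subobject.ofLE _ _ (hle i)), fun i => cokernel.π _, ?_, ?_, ?_, ?_, ?_, ?_⟩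
  · show IsZero (c 0 : H)
    rw [h0]
    exact (isZero_zero H).of_iso Subobject.botCoeIsoZero
  · show Nonempty ((c (n + 1) : H) ≅ X)
    rw [hn]
    exact ⟨asIso (⊤ : Subobject X).arrow⟩
  · intro i
    infer_instance
  · intro i
    exact ⟨cokernel.condition _,
      .mk' (ShortComplex.exact_cokernel _) (by dsimp; infer_instance) (by dsimp; infer_instance)⟩
  · intro i
    have hi := hc i (by omega)
    refine ⟨fun hz => ?_, fun A m hm hA => ?_⟩
    · have h1 := hv _ _ hi.1
      rw [← hph i, Z_zero hadd hz] at h1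
      simp at h1
    · let g := cokernel.π (Subobject.ofLE _ _ (hle i))
      let q := g ≫ cokernel.π m
      let l : Subobject X := Subobject.mk (kernel.ι q ≫ (c (i + 1)).arrow)
      have hl : l ≤ c (i + 1) :=
        Subobject.mk_le_of_comm (kernel.ι q) rfl
      have hcl : c i ≤ l :=
        Subobject.le_mk_of_comm (kernel.lift q (Subobject.ofLE _ _ (hle i)) (by simp [q, g]))
          (by simp)
      have e1 : Z (l : H) = Z (kernel q) := Z_iso hadd (Subobject.underlyingIso _)
      have e2 := Z_ker hadd q
      have e3 := Z_coker hadd m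
      have e4 := hQ i
      have e5 : Z A = Z (l : H) - Z (c i : H) := by
        linear_combination e4 - e3 - e1 + e2
      have hlt : c i < l := by
        refine lt_of_le_of_ne hcl fun h => ?_
        have := hstab A hA
        rw [e5, ← h] at this
        simp at this
      have h := hi.2 l hlt hl
      rw [← hph i, ph] at h
      rw [e5]
      exact h
  · intro i j hij
    rw [hph, hph]
    have key : ∀ j' : ℕ, j' ≤ n → ∀ i' < j', ph (fun S : Subobject X => Z (S : H)) (c j') (c (j' + 1))
        < ph (fun S : Subobject X => Z (S : H)) (c i') (c (i' + 1)) := by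
      intro j'
      induction j' with
      | zero => intro _ i' hi'; omega
      | succ k ihk =>
        intro hk i' hi'
        have h1 := hd k (by omega)
        rcases (Nat.lt_succ_iff.1 hi').eq_or_lt with rfl | h
        · exact h1
        · exact h1.trans (ihk (by omega) i' h)
    exact key j (by omega) i hij

end Paper
end
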